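/- If B is a non-atomic σ-finite c.c. Boolean algebra, then there is a generalized Galois-Tukey connection from the eventual-domination system (ωω, ≤*, ωω) to Part*(B). Consequently 𝔟(Part*(B)) ≤ 𝔟 and 𝔡 ≤ 𝔡(Part*(B)). -/

import Mathlib

/-- A relational system `⟨A₋, A, A₊⟩`. -/
structure RelSys : Type 1 where
  Dom : Type
  Cod : Type
  Rel : Dom → Cod → Prop

/-- The dominating number `𝔡(A)` of a relational system. -/
noncomputable def dNum (S : RelSys) : Cardinal :=
  sInf { c | ∃ Y : Set S.Cod, Cardinal.mk Y = c ∧ ∀ x : S.Dom, ∃ y ∈ Y, S.Rel x y }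

/-- The bounding number `𝔟(A)` of a relational system. -/
noncomputable def bNum (S : RelSys) : Cardinal :=
  sInf { c | ∃ X : Set S.Dom, Cardinal.mk X = c ∧ ∀ y : S.Cod, ∃ x ∈ X, ¬ S.Rel x y }

/-- A generalized Galois–Tukey connection from `S` to `T` (`S ≤_T T`). -/
def GT (S T : RelSys) : Prop :=
  ∃ (φm : S.Dom → T.Dom) (φp : T.Cod → S.Cod),
    ∀ a b, T.Rel (φm a) b → S.Rel a (φp b)

/-- Galois–Tukey equivalence. -/
def GTequiv (S T : RelSys) : Prop := GT S T ∧ GT T S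

/-- The σ-version `A^σ` of a relational system. -/
def sigmaSys (S : RelSys) : RelSys :=
  ⟨S.Dom, ℕ → S.Cod, fun a f => ∃ n, S.Rel a (f n)⟩

/-- Sequential composition `A;B` of relational systems. -/
def seqComp (S T : RelSys) : RelSys :=
  ⟨S.Dom × (S.Cod → T.Dom), S.Cod × T.Cod,
   fun p q => S.Rel p.1 q.1 ∧ T.Rel (p.2 q.1) q.2⟩

/-- An antichain in a Boolean algebra: pairwise disjoint nonzero elements. -/
def BAAntichain {α : Type} [BooleanAlgebra α] (A : Set α) : Prop :=
  (∀ a ∈ A, a ≠ ⊥) ∧ ∀ a ∈ A, ∀ b ∈ A, a ≠ b → a ⊓ b = ⊥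

/-- A maximal antichain in a Boolean algebra. -/
def MaxAC {α : Type} [BooleanAlgebra α] (A : Set α) : Prop :=
  BAAntichain A ∧ ∀ b : α, b ≠ ⊥ → ∃ a ∈ A, a ⊓ b ≠ ⊥

/-- The countable chain condition. -/
def CCC (α : Type) [BooleanAlgebra α] : Prop :=
  ∀ A : Set α, BAAntichain A → A.Countable

/-- `C` refines `A` (written `A ≤ C`): every element of `C` is below some element of `A`. -/
def Refines {α : Type} [BooleanAlgebra α] (A C : Set α) : Prop :=
  ∀ c ∈ C, ∃ a ∈ A, c ≤ a

/-- `C` almost refines `A` (written `A ≤* C`). -/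
def AlmostRefines {α : Type} [BooleanAlgebra α] (A C : Set α) : Prop :=
  ∃ F : Finset α, ↑F ⊆ A ∧ Refines ((A \ ↑F) ∪ {F.sup id}) C

/-- The set of maximal antichains of `α`. -/
def PartT (α : Type) [BooleanAlgebra α] : Type := {A : Set α // MaxAC A}

/-- The refinement relational system `Part(α)`. -/
def PartSys (α : Type) [BooleanAlgebra α] : RelSys :=
  ⟨PartT α, PartT α, fun A C => Refines A.1 C.1⟩

/-- The almost-refinement relational system `Part*(α)`. -/
def PartStar (α : Type) [BooleanAlgebra α] : RelSys :=
  ⟨PartT α, PartT α, fun A C => AlmostRefines A.1 C.1⟩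

/-- The eventual domination relational system `(ωω, ≤*, ωω)`. -/
def domSys : RelSys :=
  ⟨ℕ → ℕ, ℕ → ℕ, fun f g => ∀ᶠ n in Filter.atTop, f n ≤ g n⟩

/-- A Boolean algebra is σ-finite c.c. if `B⁺` is a countable union of sets
in which every antichain is finite. -/
def SigmaFiniteCC (α : Type) [BooleanAlgebra α] : Prop :=
  ∃ S : ℕ → Set α, (∀ b : α, b ≠ ⊥ → ∃ n, b ∈ S n) ∧
    ∀ n, ∀ A : Set α, A ⊆ S n → BAAntichain A → A.Finite

theorem ac_extend {α : Type} [BooleanAlgebra α] (D A0 : Set α) (h0 : BAAntichain A0) (hD : A0 ⊆ D) :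
    ∃ A, A0 ⊆ A ∧ A ⊆ D ∧ BAAntichain A ∧ ∀ x ∈ D, x ≠ ⊥ → ∃ a ∈ A, a ⊓ x ≠ ⊥ := by
  obtain ⟨A, hA0, hA⟩ := zorn_subset_nonempty {A : Set α | A ⊆ D ∧ BAAntichain A} (by
    intro c hc hch _
    refine ⟨⋃₀ c, ⟨Set.sUnion_subset fun s hs => (hc hs).1, ?_, ?_⟩,
      fun s hs => Set.subset_sUnion_of_mem hs⟩
    · rintro a ⟨s, hs, has⟩
      exact (hc hs).2.1 a has
    · rintro a ⟨s, hs, has⟩ b ⟨t, ht, hbt⟩ hab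
      rcases hch.total hs ht with hst | hst
      · exact (hc ht).2.2 a (hst has) b hbt hab
      · exact (hc hs).2.2 a has b (hst hbt) hab) A0 ⟨hD, h0⟩
  refine ⟨A, hA0, hA.prop.1, hA.prop.2, fun x hx hx0 => ?_⟩
  by_contra hcon
  push Not at hcon
  have hins : insert x A ⊆ D ∧ BAAntichain (insert x A) := by
    refine ⟨Set.insert_subset hx hA.prop.1, ?_, ?_⟩
    · rintro a (rfl | ha)
      · exact hx0
      · exact hA.prop.2.1 a ha
    · rintro a (rfl | ha) b (rfl | hb) hab
      · exact absurd rfl hab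
      · rw [inf_comm]; exact hcon b hb
      · exact hcon a ha
      · exact hA.prop.2.2 a ha b hb hab
  have hxA : x ∈ A := hA.le_of_ge hins (Set.subset_insert x A) (Set.mem_insert x A)
  have := hcon x hxA
  rw [inf_idem] at this
  exact hx0 this

theorem atomless_seq {α : Type} [BooleanAlgebra α] (d : α) (hd : d ≠ ⊥)
    (hat : ∀ x, x ≤ d → ¬ IsAtom x) :
    ∃ a : ℕ → α, (∀ n, a n ≠ ⊥) ∧ (∀ n, a n ≤ d) ∧ ∀ m n, m ≠ n → a m ⊓ a n = ⊥ := by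
  have hs : ∀ x : {x : α // x ≠ ⊥ ∧ x ≤ d}, ∃ y : {x : α // x ≠ ⊥ ∧ x ≤ d}, y.1 < x.1 := by
    rintro ⟨x, hx0, hxd⟩
    have h1 := hat x hxd
    rw [IsAtom] at h1
    push Not at h1
    obtain ⟨y, hy, hy0⟩ := h1 hx0
    exact ⟨⟨y, hy0, hy.le.trans hxd⟩, hy⟩
  choose s hs using hs
  let r : ℕ → {x : α // x ≠ ⊥ ∧ x ≤ d} := fun n => s^[n] ⟨d, hd, le_rfl⟩
  have hr : ∀ n, (r (n+1)).1 < (r n).1 := by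
    intro n
    simp only [r, Function.iterate_succ_apply']
    exact hs _
  have hanti : Antitone fun n => (r n).1 := antitone_nat_of_succ_le fun n => (hr n).le
  have key : ∀ m n, m < n → ((r m).1 \ (r (m+1)).1) ⊓ ((r n).1 \ (r (n+1)).1) = ⊥ := by
    intro m n hmn
    have h1 : (r n).1 ≤ (r (m+1)).1 := hanti hmn
    exact (disjoint_sdiff_self_left.mono_right (sdiff_le.trans h1)).eq_bot
  refine ⟨fun n => (r n).1 \ (r (n+1)).1, fun n h0 => ?_, fun n => sdiff_le.trans (r n).2.2, ?_⟩
  · exact (hr n).not_ge (sdiff_eq_bot_iff.1 h0)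
  · intro m n hmn
    rcases lt_or_gt_of_ne hmn with h1 | h1
    · exact key m n h1
    · rw [inf_comm]; exact key n m h1

theorem upclosed_fin {α : Type} [BooleanAlgebra α] (S : Set α)
    (hS : ∀ A : Set α, A ⊆ S → BAAntichain A → A.Finite) (A : Set α) (hA : BAAntichain A) :
    {x ∈ A | ∃ y ∈ S, y ≠ ⊥ ∧ y ≤ x}.Finite := by
  classical
  have hch : ∀ x : α, ∃ y, (∃ y ∈ S, y ≠ ⊥ ∧ y ≤ x) → y ∈ S ∧ y ≠ ⊥ ∧ y ≤ x := by
    intro x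
    by_cases hx : ∃ y ∈ S, y ≠ ⊥ ∧ y ≤ x
    · obtain ⟨y, hy⟩ := hx
      exact ⟨y, fun _ => hy⟩
    · exact ⟨⊥, fun h => absurd h hx⟩
  choose p hp using hch
  apply Set.Finite.of_finite_image (f := p)
  · apply hS
    · rintro _ ⟨x, hx, rfl⟩
      exact (hp x hx.2).1
    · constructor
      · rintro _ ⟨x, hx, rfl⟩
        exact (hp x hx.2).2.1
      · rintro _ ⟨x, hx, rfl⟩ _ ⟨z, hz, rfl⟩ hne
        have hxz : x ≠ z := fun h => hne (by rw [h])
        have h1 := hA.2 x hx.1 z hz.1 hxz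
        exact le_bot_iff.1 (h1 ▸ inf_le_inf (hp x hx.2).2.2 (hp z hz.2).2.2)
  · intro x hx z hz hxz
    by_contra hne
    have h1 := hA.2 x hx.1 z hz.1 hne
    apply (hp x hx.2).2.1
    exact le_bot_iff.1 (h1 ▸ le_inf (hp x hx.2).2.2 (hxz ▸ (hp z hz.2).2.2))

theorem gt_main (α : Type) [BooleanAlgebra α]
    (h : SigmaFiniteCC α) (hna : ¬ IsAtomic α) : GT domSys (PartStar α) := by
  classical
  obtain ⟨S, hcov, hfin⟩ := h
  -- an atomless element
  obtain ⟨d, hd0, hat⟩ : ∃ d : α, d ≠ ⊥ ∧ ∀ x, x ≤ d → ¬ IsAtom x := by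
    by_contra hcon
    push Not at hcon
    refine hna ⟨fun b => ?_⟩
    by_cases hb : b = ⊥
    · exact Or.inl hb
    · obtain ⟨x, hx, hxa⟩ := hcon b hb
      exact Or.inr ⟨x, hxa, hx⟩
  let T : ℕ → Set α := fun k => {x | ∃ i ≤ k, ∃ y ∈ S i, y ≠ ⊥ ∧ y ≤ x}
  have Tup : ∀ k x z, x ∈ T k → x ≤ z → z ∈ T k := by
    rintro k x z ⟨i, hi, y, hy, hy0, hyx⟩ hxz
    exact ⟨i, hi, y, hy, hy0, hyx.trans hxz⟩
  have Tmono : ∀ k l x, k ≤ l → x ∈ T k → x ∈ T l := by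
    rintro k l x hkl ⟨i, hi, hy⟩
    exact ⟨i, hi.trans hkl, hy⟩
  have Tcov : ∀ x, x ≠ ⊥ → ∃ k, x ∈ T k := by
    intro x hx
    obtain ⟨n, hn⟩ := hcov x hx
    exact ⟨n, n, le_rfl, x, hn, hx, le_rfl⟩
  have Tfin : ∀ k (A : Set α), A ⊆ T k → BAAntichain A → A.Finite := by
    intro k A hAT hA
    refine Set.Finite.subset (Set.Finite.biUnion (Set.finite_Iic k)
      (fun i _ => upclosed_fin (S i) (hfin i) A hA)) ?_
    intro x hx
    obtain ⟨i, hi, hy⟩ := hAT hx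
    exact Set.mem_biUnion (Set.mem_Iic.2 hi) ⟨hx, hy⟩
  -- density of the complement of `T k` below `d`
  have dense : ∀ k x, x ≠ ⊥ → x ≤ d → ∃ y, y ≠ ⊥ ∧ y ≤ x ∧ y ∉ T k := by
    intro k x hx hxd
    by_contra hcon
    push Not at hcon
    obtain ⟨a, ha0, hax, had⟩ := atomless_seq x hx (fun z hz => hat z (hz.trans hxd))
    have hf : (Set.range a).Finite := by
      apply Tfin k
      · rintro _ ⟨n, rfl⟩
        exact hcon _ (ha0 n) (hax n)
      · constructor
        · rintro _ ⟨n, rfl⟩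
          exact ha0 n
        · rintro _ ⟨n, rfl⟩ _ ⟨m, rfl⟩ hne
          exact had n m (fun h => hne (by rw [h]))
    refine Set.infinite_range_of_injective (f := a) ?_ hf
    intro m n hmn
    by_contra hne
    have h1 := had m n hne
    rw [← hmn, inf_idem] at h1
    exact ha0 m h1
  obtain ⟨a, ha0, hald, hadis⟩ := atomless_seq d hd0 hat
  have hP : ∀ n k, ∃ P : Set α, BAAntichain P ∧ (∀ x ∈ P, x ≤ a n ∧ x ∉ T k) ∧
      ∀ x, x ⊓ a n ≠ ⊥ → ∃ p ∈ P, p ⊓ x ≠ ⊥ := by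
    intro n k
    obtain ⟨P, -, hPD, hPA, hPm⟩ := ac_extend {x | x ≤ a n ∧ x ∉ T k} ∅
      ⟨by simp, by simp⟩ (Set.empty_subset _)
    refine ⟨P, hPA, fun x hx => hPD hx, fun x hx => ?_⟩
    obtain ⟨y, hy0, hyx, hyT⟩ := dense k _ hx (inf_le_right.trans (hald n))
    obtain ⟨p, hp, hpy⟩ := hPm y ⟨hyx.trans inf_le_right, hyT⟩ hy0
    exact ⟨p, hp, fun h => hpy (le_bot_iff.1 (h ▸ inf_le_inf_left p (hyx.trans inf_le_left)))⟩
  choose P hPA hPT hPm using hP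
  have hAf : ∀ f : ℕ → ℕ, ∃ A : Set α, MaxAC A ∧ ∀ n, P n (f n) ⊆ A := by
    intro f
    have hU : BAAntichain (⋃ n, P n (f n)) := by
      constructor
      · intro x hx
        obtain ⟨n, hn⟩ := Set.mem_iUnion.1 hx
        exact (hPA n (f n)).1 x hn
      · intro x hx y hy hxy
        obtain ⟨n, hn⟩ := Set.mem_iUnion.1 hx
        obtain ⟨m, hm⟩ := Set.mem_iUnion.1 hy
        by_cases hnm : n = m
        · subst hnm
          exact (hPA n (f n)).2 x hn y hm hxy
        · exact le_bot_iff.1 (hadis n m hnm ▸ inf_le_inf (hPT n _ x hn).1 (hPT m _ y hm).1)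
    obtain ⟨A, hUA, -, hA, hAm⟩ := ac_extend Set.univ _ hU (Set.subset_univ _)
    exact ⟨A, ⟨hA, fun b hb => hAm b trivial hb⟩,
      fun n => (Set.subset_iUnion (fun n => P n (f n)) n).trans hUA⟩
  choose Af hAf hPAf using hAf
  have hmeet : ∀ f n x, x ∈ Af f → x ⊓ a n ≠ ⊥ → x ∈ P n (f n) := by
    intro f n x hx hxa
    obtain ⟨p, hp, hpx⟩ := hPm n (f n) x hxa
    by_contra hcon
    have hne : p ≠ x := fun h => hcon (h ▸ hp)
    exact hpx ((hAf f).1.2 p (hPAf f n hp) x hx hne)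
  have hg : ∀ C : PartT α, ∀ n, ∃ k, ∃ c ∈ C.1, c ⊓ a n ≠ ⊥ ∧ c ⊓ a n ∈ T k := by
    intro C n
    obtain ⟨c, hc, hca⟩ := C.2.2 (a n) (ha0 n)
    obtain ⟨k, hk⟩ := Tcov _ hca
    exact ⟨k, c, hc, hca, hk⟩
  choose g c hc hca hcT using hg
  refine ⟨fun f => ⟨Af f, hAf f⟩, fun C => g C, ?_⟩
  rintro f C ⟨F, hFA, hR⟩
  change (F : Set α) ⊆ Af f at hFA
  have hfinN : {n | ∃ x ∈ F, x ⊓ a n ≠ ⊥}.Finite := by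
    have : {n | ∃ x ∈ F, x ⊓ a n ≠ ⊥} ⊆ ⋃ x ∈ (F : Set α), {n | x ⊓ a n ≠ ⊥} := by
      rintro n ⟨x, hx, hxn⟩
      exact Set.mem_biUnion (Finset.mem_coe.2 hx) hxn
    refine Set.Finite.subset (Set.Finite.biUnion F.finite_toSet fun x hx => ?_) this
    refine Set.Subsingleton.finite ?_
    intro m hm n hn
    by_contra hne
    have h1 := (hPT m _ x (hmeet f m x (hFA hx) hm)).1
    exact hn (le_bot_iff.1 (hadis m n hne ▸ inf_le_inf_right (a n) h1))
  change ∀ᶠ n in Filter.atTop, f n ≤ g C n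
  rw [← Nat.cofinite_eq_atTop]
  filter_upwards [hfinN.compl_mem_cofinite] with n hn
  have hn' : ∀ x ∈ F, x ⊓ a n = ⊥ := by
    intro x hx
    by_contra h1
    exact hn ⟨x, hx, h1⟩
  by_contra hlt
  obtain ⟨x, hx, hcx⟩ := hR (c C n) (hc C n)
  rcases hx with hx | hx
  · have hxa : x ⊓ a n ≠ ⊥ := fun h1 =>
      hca C n (le_bot_iff.1 (h1 ▸ inf_le_inf_right (a n) hcx))
    have hxP := hmeet f n x hx.1 hxa
    apply (hPT n _ x hxP).2
    exact Tup _ _ _ (Tmono _ _ _ (not_le.1 hlt).le (hcT C n)) (inf_le_left.trans hcx)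
  · have hxF : x = F.sup id := hx
    have hdis : Disjoint (F.sup id) (a n) := by
      rw [Finset.disjoint_sup_left]
      intro y hy
      exact disjoint_iff.2 (hn' y hy)
    apply hca C n
    exact (hdis.mono_left (hxF ▸ hcx)).eq_bot

theorem gt_bNum {S T : RelSys} (h : GT S T)
    (hS : ∀ y : S.Cod, ∃ x : S.Dom, ¬ S.Rel x y) : bNum T ≤ bNum S := by
  obtain ⟨φ, ψ, hφ⟩ := h
  refine le_csInf ⟨_, Set.univ, rfl, fun y => ?_⟩ ?_
  · obtain ⟨x, hx⟩ := hS y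
    exact ⟨x, trivial, hx⟩
  · rintro _ ⟨X, rfl, hX⟩
    refine (csInf_le' ?_).trans (Cardinal.mk_image_le (f := φ) (s := X))
    refine ⟨φ '' X, rfl, fun y => ?_⟩
    obtain ⟨x, hx, hxy⟩ := hX (ψ y)
    exact ⟨φ x, ⟨x, hx, rfl⟩, fun h1 => hxy (hφ _ _ h1)⟩

theorem gt_dNum {S T : RelSys} (h : GT S T)
    (hT : ∀ x : T.Dom, ∃ y : T.Cod, T.Rel x y) : dNum S ≤ dNum T := by
  obtain ⟨φ, ψ, hφ⟩ := h
  refine le_csInf ⟨_, Set.univ, rfl, fun x => ?_⟩ ?_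
  · obtain ⟨y, hy⟩ := hT x
    exact ⟨y, trivial, hy⟩
  · rintro _ ⟨Y, rfl, hY⟩
    refine (csInf_le' ?_).trans (Cardinal.mk_image_le (f := ψ) (s := Y))
    refine ⟨ψ '' Y, rfl, fun x => ?_⟩
    obtain ⟨y, hy, hxy⟩ := hY (φ x)
    exact ⟨ψ y, ⟨y, hy, rfl⟩, hφ _ _ hxy⟩

/-- If `B` is a non-atomic σ-finite c.c. Boolean algebra, then
`(ωω, ≤*, ωω) ≤_T Part*(B)`; consequently `𝔟(Part*(B)) ≤ 𝔟` and `𝔡 ≤ 𝔡(Part*(B))`. -/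
theorem stmt11 (α : Type) [BooleanAlgebra α]
    (h : SigmaFiniteCC α) (hna : ¬ IsAtomic α) :
    GT domSys (PartStar α) ∧
      bNum (PartStar α) ≤ bNum domSys ∧ dNum domSys ≤ dNum (PartStar α) := by
  have hGT := gt_main α h hna
  refine ⟨hGT, gt_bNum hGT ?_, gt_dNum hGT ?_⟩
  · intro g
    refine ⟨fun n => g n + 1, fun hcon => ?_⟩
    obtain ⟨n, hn⟩ := Filter.Eventually.exists (f := Filter.atTop) hcon
    exact Nat.not_succ_le_self _ hn
  · intro A
    refine ⟨A, ∅, by simp, fun c hc => ⟨c, Or.inl ⟨hc, by simp⟩, le_rfl⟩⟩
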